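/- For every prime power q, the group SL₂(F_q) is not a characteristic quotient of F₂, and the group PSL₂(F_q) is not a characteristic quotient of F₂. -/

import Mathlib

/-- `G` is a characteristic quotient of the free group `F₂` on two generators. -/
def IsCharacteristicQuotientOfF2 (G : Type*) [Group G] : Prop :=
  ∃ φ : FreeGroup (Fin 2) →* G, Function.Surjective φ ∧ (MonoidHom.ker φ).Characteristic

open scoped MatrixGroups

namespace CharacteristicQuotient

section Group

variable {G : Type*} [Group G]

/-- Automorphisms of the source descend along a surjection with characteristic kernel. -/
theorem exists_mulEquiv_comp {A : Type*} [Group A] {φ : A →* G} (hφ : Function.Surjective φ)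
    (hker : φ.ker.Characteristic) (α : A ≃* A) : ∃ σ : G ≃* G, ∀ w, σ (φ w) = φ (α w) := by
  let e := QuotientGroup.quotientKerEquivOfSurjective φ hφ
  let c := QuotientGroup.congr φ.ker φ.ker α (Subgroup.characteristic_iff_map_eq.mp hker α)
  refine ⟨(e.symm.trans c).trans e, fun w => ?_⟩
  have h : e.symm (φ w) = (w : A ⧸ φ.ker) := by
    rw [MulEquiv.symm_apply_eq]; rfl
  simp only [MulEquiv.trans_apply, h]
  rfl

theorem _root_.IsCharacteristicQuotientOfF2.quotient_center
    (h : IsCharacteristicQuotientOfF2 G) :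
    IsCharacteristicQuotientOfF2 (G ⧸ Subgroup.center G) := by
  obtain ⟨φ, hφ, hker⟩ := h
  refine ⟨(QuotientGroup.mk' (Subgroup.center G)).comp φ,
    (QuotientGroup.mk'_surjective _).comp hφ, ?_⟩
  rw [Subgroup.characteristic_iff_le_comap]
  intro α w hw
  obtain ⟨σ, hσ⟩ := exists_mulEquiv_comp hφ hker α
  have hc : (Subgroup.center G).Characteristic := inferInstance
  have hw' : φ w ∈ Subgroup.center G := by simpa [MonoidHom.mem_ker] using hw
  have := Subgroup.characteristic_iff_le_comap.mp hc σ hw'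
  have h2 : φ (α w) ∈ Subgroup.center G := by simpa [hσ] using this
  simpa [MonoidHom.mem_ker] using h2

/-- The automorphism `x ↦ y, y ↦ x` of `F₂`. -/
def swapAut : FreeGroup (Fin 2) ≃* FreeGroup (Fin 2) :=
  FreeGroup.freeGroupCongr (Equiv.swap 0 1)

/-- The automorphism `x ↦ y, y ↦ (xy)⁻¹` of `F₂`. -/
def rotateAut : FreeGroup (Fin 2) ≃* FreeGroup (Fin 2) :=
  MonoidHom.toMulEquiv
    (FreeGroup.lift ![.of 1, (.of 0 * .of 1)⁻¹])
    (FreeGroup.lift ![(.of 0 * .of 1)⁻¹, .of 0])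
    (by ext i; fin_cases i <;> simp)
    (by ext i; fin_cases i <;> simp)

/-- The automorphism `x ↦ x, y ↦ xy` of `F₂`. -/
def shearAut : FreeGroup (Fin 2) ≃* FreeGroup (Fin 2) :=
  MonoidHom.toMulEquiv
    (FreeGroup.lift ![.of 0, .of 0 * .of 1])
    (FreeGroup.lift ![.of 0, (.of 0)⁻¹ * .of 1])
    (by ext i; fin_cases i <;> simp)
    (by ext i; fin_cases i <;> simp)

theorem commute_of_commute_generators {φ : FreeGroup (Fin 2) →* G} (hφ : Function.Surjective φ)
    (h : Commute (φ (.of 0)) (φ (.of 1))) (a b : G) : Commute a b := by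
  have key : ∀ g : G, Commute g (φ (.of 0)) → Commute g (φ (.of 1)) → ∀ b, Commute g b := by
    intro g h0 h1 b
    obtain ⟨w, rfl⟩ := hφ b
    induction w using FreeGroup.induction_on with
    | C1 => simp
    | of i => fin_cases i <;> assumption
    | inv_of i hi => simpa using hi
    | mul u v hu hv => simpa using hu.mul_right hv
  exact key a (key _ (.refl _) h a).symm (key _ h.symm (.refl _) a).symm b

end Group

section Field

variable {F : Type*} [Field F]

/-- Two endomorphisms of a finite field commute. -/
theorem ringHom_comm_apply [Finite F] (f g : F →+* F) (a : F) : f (g a) = g (f a) := by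
  obtain ⟨ζ, hζ⟩ := IsCyclic.exists_generator (α := Fˣ)
  have hpow : ∀ b : F, b ≠ 0 → ∃ n : ℤ, b = (ζ : F) ^ n := fun b hb => by
    obtain ⟨n, hn⟩ := hζ (Units.mk0 b hb)
    exact ⟨n, by simpa using (congrArg Units.val hn).symm⟩
  rcases eq_or_ne a 0 with rfl | ha
  · simp
  obtain ⟨n, rfl⟩ := hpow a ha
  obtain ⟨i, hi⟩ := hpow (f ζ) (by simp)
  obtain ⟨j, hj⟩ := hpow (g ζ) (by simp)
  simp only [map_zpow₀, hi, hj, ← zpow_mul]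
  congr 1; ring

/-- An additive map satisfying `f (r t²) = f r (f t)²` and `f 1 = 1` is a ring homomorphism, over
a finite field. -/
theorem map_mul_of_map_mul_sq [Finite F] (f : F →+ F) (h1 : f 1 = 1)
    (h : ∀ r t, f (r * t ^ 2) = f r * f t ^ 2) (a b : F) : f (a * b) = f a * f b := by
  have hs : ∀ t, f (t ^ 2) = f t ^ 2 := fun t => by simpa [h1] using h 1 t
  by_cases h2 : (2 : F) = 0
  · have : CharP F 2 := CharTwo.of_one_ne_zero_of_two_eq_zero one_ne_zero h2
    obtain ⟨c, rfl⟩ : ∃ c, c ^ 2 = b := (bijective_frobenius F 2).surjective b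
    rw [h, hs]
  · have hp : f ((a + b) ^ 2) = f (a ^ 2) + f (b ^ 2) + f (a * b) + f (a * b) := by
      rw [← map_add, ← map_add, ← map_add]; congr 1; ring
    rw [hs, hs, hs, map_add] at hp
    have : 2 * (f (a * b) - f a * f b) = 0 := by linear_combination -hp
    exact sub_eq_zero.mp ((mul_eq_zero.mp this).resolve_left h2)

end Field

section SL2

variable {F : Type*} [Field F]

theorem SL2_ext_iff {g h : SL(2, F)} :
    g = h ↔ g 0 0 = h 0 0 ∧ g 0 1 = h 0 1 ∧ g 1 0 = h 1 0 ∧ g 1 1 = h 1 1 := by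
  simp [Matrix.SpecialLinearGroup.ext_iff, Fin.forall_fin_two, and_assoc]

theorem SL2_mul_apply (g h : SL(2, F)) (i j : Fin 2) :
    (g * h) i j = g i 0 * h 0 j + g i 1 * h 1 j := by
  simp [Matrix.mul_apply]

theorem SL2_neg_apply (g : SL(2, F)) (i j : Fin 2) : (-g) i j = -g i j := by
  simp

theorem SL2_inv (g : SL(2, F)) :
    g⁻¹ 0 0 = g 1 1 ∧ g⁻¹ 0 1 = -g 0 1 ∧ g⁻¹ 1 0 = -g 1 0 ∧ g⁻¹ 1 1 = g 0 0 := by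
  simp [Matrix.SpecialLinearGroup.coe_inv, Matrix.adjugate_fin_two]

theorem SL2_det (g : SL(2, F)) : g 0 0 * g 1 1 - g 0 1 * g 1 0 = 1 := by
  rw [← Matrix.det_fin_two]; exact g.det_coe

/-- The projection of `SL₂` onto `PSL₂`. -/
abbrev proj : SL(2, F) →* SL(2, F) ⧸ Subgroup.center SL(2, F) :=
  QuotientGroup.mk' _

theorem proj_surjective : Function.Surjective (proj (F := F)) :=
  QuotientGroup.mk'_surjective _

theorem proj_neg (g : SL(2, F)) : proj (-g) = proj g := by
  rw [QuotientGroup.mk'_apply, QuotientGroup.mk'_apply, QuotientGroup.eq,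
    Matrix.SpecialLinearGroup.mem_center_iff]
  exact ⟨-1, by simp, by ext i j; fin_cases i <;> fin_cases j <;> simp⟩

theorem proj_eq_proj_iff {g h : SL(2, F)} : proj g = proj h ↔ g = h ∨ g = -h := by
  refine ⟨fun hgh => ?_, ?_⟩
  · rw [eq_comm, QuotientGroup.mk'_apply, QuotientGroup.mk'_apply, QuotientGroup.eq,
      Matrix.SpecialLinearGroup.mem_center_iff] at hgh
    obtain ⟨r, hr, hc⟩ := hgh
    have hc' : h⁻¹ * g = 1 ∨ h⁻¹ * g = -1 := by
      have hr' : r = 1 ∨ r = -1 := sq_eq_one_iff.mp (by simpa using hr)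
      refine hr'.imp (fun h1 => ?_) fun h1 => ?_ <;> apply Subtype.ext <;> rw [← hc, h1] <;>
        ext i j <;> fin_cases i <;> fin_cases j <;> simp
    refine hc'.imp (fun h1 => ?_) fun h1 => ?_
    · rw [inv_mul_eq_iff_eq_mul.mp h1, mul_one]
    · rw [inv_mul_eq_iff_eq_mul.mp h1, mul_neg, mul_one]
  · rintro (rfl | rfl)
    exacts [rfl, proj_neg h]

/-- The upper unipotent matrix with off-diagonal entry `t`. -/
def upper (t : F) : SL(2, F) := ⟨!![1, t; 0, 1], by simp⟩

/-- The lower unipotent matrix with off-diagonal entry `t`. -/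
def lower (t : F) : SL(2, F) := ⟨!![1, 0; t, 1], by simp⟩

theorem upper_apply (t : F) :
    upper t 0 0 = 1 ∧ upper t 0 1 = t ∧ upper t 1 0 = 0 ∧ upper t 1 1 = 1 := by
  simp [upper]

theorem lower_apply (t : F) :
    lower t 0 0 = 1 ∧ lower t 0 1 = 0 ∧ lower t 1 0 = t ∧ lower t 1 1 = 1 := by
  simp [lower]

theorem upper_zero : upper (0 : F) = 1 := by
  simp [SL2_ext_iff, upper_apply]

theorem lower_zero : lower (0 : F) = 1 := by
  simp [SL2_ext_iff, lower_apply]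

theorem upper_add (s t : F) : upper (s + t) = upper s * upper t := by
  simp [SL2_ext_iff, SL2_mul_apply, upper_apply, add_comm]

theorem lower_add (s t : F) : lower (s + t) = lower s * lower t := by
  simp [SL2_ext_iff, SL2_mul_apply, lower_apply]

theorem upper_pow (t : F) (n : ℕ) : upper t ^ n = upper (n * t) := by
  induction n with
  | zero => simp [SL2_ext_iff, upper_apply]
  | succ n ih => rw [pow_succ, ih, ← upper_add]; congr 1; push_cast; ring

theorem lower_pow (t : F) (n : ℕ) : lower t ^ n = lower (n * t) := by
  induction n with
  | zero => simp [SL2_ext_iff, lower_apply]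
  | succ n ih => rw [pow_succ, ih, ← lower_add]; congr 1; push_cast; ring

theorem proj_upper_injective : Function.Injective fun t : F => proj (upper t) := by
  intro s t h
  rcases proj_eq_proj_iff.mp h with h | h
  · simpa [SL2_ext_iff, upper_apply] using h
  · simp only [SL2_ext_iff, Matrix.SpecialLinearGroup.coe_neg, Matrix.neg_apply, upper_apply] at h
    linear_combination h.2.1 - t * h.1

theorem monoidHom_ext_of_upper_lower {H : Type*} [Monoid H] {f g : SL(2, F) →* H}
    (hu : ∀ t, f (upper t) = g (upper t)) (hl : ∀ t, f (lower t) = g (lower t)) : f = g := by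
  ext a
  induction a using Matrix.SL2.transvection_induction with
  | htransvec i j h c =>
    fin_cases i <;> fin_cases j
    · exact absurd rfl h
    · convert hu c <;>
      simp [SL2_ext_iff, upper_apply, Matrix.SpecialLinearGroup.transvection_coe]
    · convert hl c <;>
      simp [SL2_ext_iff, lower_apply, Matrix.SpecialLinearGroup.transvection_coe]
    · exact absurd rfl h
  | hmul A B hA hB => rw [map_mul, map_mul, hA, hB]

/-- In characteristic `p`, an element of `PSL₂` of order dividing `p` lifts to a unipotent. -/
theorem exists_trace_eq_two (p : ℕ) [Fact p.Prime] [CharP F p]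
    {x : SL(2, F) ⧸ Subgroup.center SL(2, F)} (hx : x ^ p = 1) :
    ∃ g : SL(2, F), proj g = x ∧ g 0 0 + g 1 1 = 2 := by
  have key : ∀ g : SL(2, F), g ^ p = 1 → g 0 0 + g 1 1 = 2 := by
    intro g hg
    have h : ((g : Matrix (Fin 2) (Fin 2) F) - 1) ^ p = 0 := by
      rw [sub_pow_char_of_commute p (Commute.one_right _), one_pow,
        ← Matrix.SpecialLinearGroup.coe_pow, hg]
      simp
    have h2 := (Matrix.isNilpotent_trace_of_isNilpotent ⟨p, h⟩).eq_zero
    rw [Matrix.trace_fin_two] at h2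
    simp at h2
    linear_combination h2
  obtain ⟨g, rfl⟩ := proj_surjective x
  rw [← map_pow, ← map_one proj, proj_eq_proj_iff] at hx
  rcases hx with h | h
  · exact ⟨g, rfl, key g h⟩
  · refine ⟨-g, proj_neg g, key _ ?_⟩
    have h1 : (-1 : SL(2, F)) ^ p = -1 := by
      apply Subtype.ext
      simpa using neg_one_pow_char (Matrix (Fin 2) (Fin 2) F) p
    rw [neg_pow, h1, h]; simp

theorem exists_conj_upper {g : SL(2, F)} (htr : g 0 0 + g 1 1 = 2) :
    ∃ h s, g = h * upper s * h⁻¹ := by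
  have hd := SL2_det g
  by_cases hc : g 1 0 = 0
  · refine ⟨1, g 0 1, ?_⟩
    have h1 : g 0 0 = 1 := by
      have : (g 0 0 - 1) ^ 2 = 0 := by
        linear_combination -hd + g 0 0 * htr - g 0 1 * hc
      linear_combination pow_eq_zero_iff (two_ne_zero) |>.mp this
    simp [SL2_ext_iff, upper_apply, hc, h1]
    linear_combination htr - h1
  · obtain ⟨h, h00, h01, h10, h11⟩ : ∃ h : SL(2, F),
        h 0 0 = g 0 0 - 1 ∧ h 0 1 = -1 / g 1 0 ∧ h 1 0 = g 1 0 ∧ h 1 1 = 0 :=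
      ⟨⟨!![g 0 0 - 1, -1 / g 1 0; g 1 0, 0], by simp; field_simp⟩, by simp⟩
    refine ⟨h, -1 / g 1 0, eq_mul_inv_of_mul_eq ?_⟩
    simp only [SL2_ext_iff, SL2_mul_apply, upper_apply, h00, h01, h10, h11]
    refine ⟨?_, ?_, ?_, ?_⟩ <;> field_simp <;> grind

theorem eq_upper_of_commute {g : SL(2, F)} {s : F} (hs : s ≠ 0) (htr : g 0 0 + g 1 1 = 2)
    (hg : Commute (proj g) (proj (upper s))) : ∃ t, g = upper t := by
  have hd := SL2_det g
  refine ⟨g 0 1, ?_⟩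
  rw [Commute, SemiconjBy, ← map_mul, ← map_mul, proj_eq_proj_iff] at hg
  simp only [SL2_ext_iff, SL2_neg_apply, SL2_mul_apply, upper_apply] at hg ⊢
  grind

theorem eq_lower_of_commute {g : SL(2, F)} {s : F} (hs : s ≠ 0) (htr : g 0 0 + g 1 1 = 2)
    (hg : Commute (proj g) (proj (lower s))) : ∃ t, g = lower t := by
  have hd := SL2_det g
  refine ⟨g 1 0, ?_⟩
  rw [Commute, SemiconjBy, ← map_mul, ← map_mul, proj_eq_proj_iff] at hg
  simp only [SL2_ext_iff, SL2_neg_apply, SL2_mul_apply, lower_apply] at hg ⊢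
  grind

theorem not_commute_upper_lower :
    ¬ Commute (proj (upper (1 : F))) (proj (lower 1)) := by
  intro hg
  rw [Commute, SemiconjBy, ← map_mul, ← map_mul, proj_eq_proj_iff] at hg
  simp only [SL2_ext_iff, SL2_neg_apply, SL2_mul_apply, upper_apply, lower_apply] at hg
  refine one_ne_zero (α := F) ?_
  rcases hg with h | h
  · linear_combination h.1
  · linear_combination h.1 - h.2.1

theorem proj_upper_pow (p : ℕ) [CharP F p] (t : F) : proj (upper t) ^ p = 1 := by
  rw [← map_pow, upper_pow, CharP.cast_eq_zero, zero_mul, upper_zero, map_one]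

theorem proj_lower_pow (p : ℕ) [CharP F p] (t : F) : proj (lower t) ^ p = 1 := by
  rw [← map_pow, lower_pow, CharP.cast_eq_zero, zero_mul, lower_zero, map_one]

theorem proj_lower_injective : Function.Injective fun t : F => proj (lower t) := by
  intro s t h
  rcases proj_eq_proj_iff.mp h with h | h
  · simpa [SL2_ext_iff, lower_apply] using h
  · simp only [SL2_ext_iff, Matrix.SpecialLinearGroup.coe_neg, Matrix.neg_apply, lower_apply] at h
    linear_combination h.2.2.1 - t * h.1

/-- Up to an inner automorphism, an automorphism of `PSL₂` maps `upper 1` to an upper and `lower 1`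
to a lower unipotent. -/
theorem exists_conj_upper_lower [Finite F]
    (σ : SL(2, F) ⧸ Subgroup.center SL(2, F) ≃* SL(2, F) ⧸ Subgroup.center SL(2, F)) :
    ∃ h s r, σ (proj (upper 1)) = proj (h * upper s * h⁻¹) ∧
      σ (proj (lower 1)) = proj (h * lower r * h⁻¹) := by
  obtain ⟨p, hp⟩ := CharP.exists F
  have : Fact p.Prime := ⟨CharP.char_is_prime F p⟩
  obtain ⟨g, hg, htr⟩ := exists_trace_eq_two p (x := σ (proj (upper 1)))
    (by rw [← map_pow, proj_upper_pow, map_one])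
  obtain ⟨h, s, rfl⟩ := exists_conj_upper htr
  obtain ⟨k, hk, hktr⟩ := exists_trace_eq_two p
    (x := MulAut.conj (proj h)⁻¹ (σ (proj (lower 1))))
    (by rw [← map_pow, ← map_pow, proj_lower_pow, map_one, map_one])
  have hk' : σ (proj (lower 1)) = proj (h * k * h⁻¹) := by
    rw [map_mul, map_mul, hk, MulAut.conj_apply, map_inv]; group
  have hd := SL2_det k
  have hr : k 1 0 ≠ 0 := by
    intro h0
    obtain ⟨t, rfl⟩ : ∃ t, k = upper t := by
      refine ⟨k 0 1, ?_⟩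
      simp only [SL2_ext_iff, upper_apply]
      grind
    refine not_commute_upper_lower (F := F) (Commute.of_map σ.injective ?_)
    rw [← hg, hk']
    refine Commute.map ?_ proj
    rw [← MulAut.conj_apply, ← MulAut.conj_apply]
    refine Commute.map ?_ _
    rw [Commute, SemiconjBy, ← upper_add, ← upper_add, add_comm]
  have hkz : k = upper (-((1 - k 0 0) / k 1 0)) * lower (k 1 0) *
      (upper (-((1 - k 0 0) / k 1 0)))⁻¹ := by
    apply eq_mul_inv_of_mul_eq
    simp only [SL2_ext_iff, SL2_mul_apply, upper_apply, lower_apply]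
    refine ⟨?_, ?_, ?_, ?_⟩ <;> field_simp <;> grind
  refine ⟨h * upper (-((1 - k 0 0) / k 1 0)), s, k 1 0, ?_, ?_⟩
  · rw [← hg]
    congr 1
    rw [mul_assoc h (upper _) (upper s), ← upper_add, add_comm, upper_add]
    group
  · rw [hk']
    congr 1
    conv_lhs => rw [hkz]
    group

theorem weyl_mul_upper {t : F} (ht : t ≠ 0) (s : F) :
    upper t * lower (-1 / t) * upper t * upper s =
      lower (-(s / t ^ 2)) * (upper t * lower (-1 / t) * upper t) := by
  simp only [SL2_ext_iff, SL2_mul_apply, upper_apply, lower_apply]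
  refine ⟨?_, ?_, ?_, ?_⟩ <;> field_simp <;> ring

theorem eq_of_weyl_mul_upper {α β a b : F} (ha : a ≠ 0)
    (h : proj (upper α * lower β * upper α * upper a) =
      proj (lower b * (upper α * lower β * upper α))) : b * α ^ 2 = - a := by
  rw [proj_eq_proj_iff] at h
  simp only [SL2_ext_iff, SL2_neg_apply, SL2_mul_apply, upper_apply, lower_apply] at h
  have h1 : α * β = -1 := by grind
  grind

/-- An automorphism of `PSL₂` preserving the upper and the lower unipotents acts on them through
a field endomorphism. -/
theorem exists_ringHom_of_normalized [Finite F]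
    (σ : SL(2, F) ⧸ Subgroup.center SL(2, F) ≃* SL(2, F) ⧸ Subgroup.center SL(2, F)) {s r : F}
    (hs : σ (proj (upper 1)) = proj (upper s)) (hr : σ (proj (lower 1)) = proj (lower r)) :
    ∃ (τ : F →+* F) (c : F), c ≠ 0 ∧ (∀ t, σ (proj (upper t)) = proj (upper (c * τ t))) ∧
      ∀ t, σ (proj (lower t)) = proj (lower (c⁻¹ * τ t)) := by
  obtain ⟨p, hp⟩ := CharP.exists F
  have : Fact p.Prime := ⟨CharP.char_is_prime F p⟩
  have hs0 : s ≠ 0 := by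
    rintro rfl
    rw [upper_zero, map_one, map_eq_one_iff σ σ.injective, ← map_one proj, ← upper_zero] at hs
    exact one_ne_zero (proj_upper_injective hs)
  have hr0 : r ≠ 0 := by
    rintro rfl
    rw [lower_zero, map_one, map_eq_one_iff σ σ.injective, ← map_one proj, ← lower_zero] at hr
    exact one_ne_zero (proj_lower_injective hr)
  have hf : ∀ t, ∃ a, σ (proj (upper t)) = proj (upper a) := by
    intro t
    obtain ⟨g, hg, htr⟩ := exists_trace_eq_two p (x := σ (proj (upper t)))
      (by rw [← map_pow, proj_upper_pow, map_one])
    obtain ⟨a, rfl⟩ := eq_upper_of_commute hs0 htr (by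
      rw [hg, ← hs]
      refine (Commute.map ?_ proj).map σ
      rw [Commute, SemiconjBy, ← upper_add, ← upper_add, add_comm])
    exact ⟨a, hg.symm⟩
  have hg : ∀ t, ∃ a, σ (proj (lower t)) = proj (lower a) := by
    intro t
    obtain ⟨g, hg, htr⟩ := exists_trace_eq_two p (x := σ (proj (lower t)))
      (by rw [← map_pow, proj_lower_pow, map_one])
    obtain ⟨a, rfl⟩ := eq_lower_of_commute hr0 htr (by
      rw [hg, ← hr]
      refine (Commute.map ?_ proj).map σ
      rw [Commute, SemiconjBy, ← lower_add, ← lower_add, add_comm])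
    exact ⟨a, hg.symm⟩
  choose f hf using hf
  choose g hg using hg
  have f_add : ∀ x y, f (x + y) = f x + f y := fun x y => by
    apply proj_upper_injective
    simp only [← hf, upper_add, map_mul]
  have g_add : ∀ x y, g (x + y) = g x + g y := fun x y => by
    apply proj_lower_injective
    simp only [← hg, lower_add, map_mul]
  let f' : F →+ F := AddMonoidHom.mk' f f_add
  let g' : F →+ F := AddMonoidHom.mk' g g_add
  have f0 : f 0 = 0 := f'.map_zero
  have g0 : g 0 = 0 := g'.map_zero
  have g_neg : ∀ x, g (-x) = - g x := g'.map_neg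
  have f_ne : ∀ x, x ≠ 0 → f x ≠ 0 := fun x hx h0 => hx <| by
    apply proj_upper_injective
    apply σ.injective
    simp only [hf, h0, f0]
  have key : ∀ t x, t ≠ 0 → g (x / t ^ 2) * f t ^ 2 = f x := by
    intro t x ht
    rcases eq_or_ne x 0 with rfl | hx
    · simp [f0, g0]
    have := congrArg (fun y => σ (proj y)) (weyl_mul_upper ht x)
    simp only [map_mul, hf, hg] at this
    simp only [← map_mul] at this
    have := eq_of_weyl_mul_upper (f_ne x hx) this
    rw [g_neg] at this
    linear_combination -this
  have hc : f 1 ≠ 0 := f_ne 1 one_ne_zero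
  have g_eq : ∀ x, g x * f 1 ^ 2 = f x := fun x => by simpa using key 1 x one_ne_zero
  let τ₀ : F →+ F := (AddMonoidHom.mulLeft (f 1)⁻¹).comp f'
  have hτ : ∀ x, τ₀ x = (f 1)⁻¹ * f x := fun x => rfl
  have hτ1 : τ₀ 1 = 1 := by rw [hτ, inv_mul_cancel₀ hc]
  have hmul := map_mul_of_map_mul_sq τ₀ hτ1 (by
    intro x t
    simp only [hτ]
    rcases eq_or_ne t 0 with rfl | ht
    · simp [f0]
    have h1 := key t (x * t ^ 2) ht
    rw [mul_div_cancel_right₀ _ (pow_ne_zero 2 ht)] at h1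
    rw [← h1, ← g_eq x]
    field_simp)
  refine ⟨⟨⟨⟨τ₀, hτ1⟩, hmul⟩, τ₀.map_zero, τ₀.map_add⟩, f 1, hc, fun t => ?_, fun t => ?_⟩
  · rw [hf]
    congr 2
    change f t = f 1 * ((f 1)⁻¹ * f t)
    field_simp
  · rw [hg]
    congr 2
    change g t = (f 1)⁻¹ * ((f 1)⁻¹ * f t)
    rw [← g_eq t]
    field_simp

/-- Apply a field endomorphism to the entries and conjugate by the diagonal matrix `(c, 1)`. -/
def twistFun (τ : F →+* F) (c : F) (hc : c ≠ 0) (g : SL(2, F)) : SL(2, F) :=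
  ⟨!![τ (g 0 0), c * τ (g 0 1); c⁻¹ * τ (g 1 0), τ (g 1 1)], by
    have h := congrArg τ (SL2_det g)
    simp only [map_sub, map_mul, map_one] at h
    rw [Matrix.det_fin_two_of]
    refine Eq.trans ?_ h
    field_simp⟩

theorem twistFun_apply (τ : F →+* F) {c : F} (hc : c ≠ 0) (g : SL(2, F)) :
    twistFun τ c hc g 0 0 = τ (g 0 0) ∧ twistFun τ c hc g 0 1 = c * τ (g 0 1) ∧
      twistFun τ c hc g 1 0 = c⁻¹ * τ (g 1 0) ∧ twistFun τ c hc g 1 1 = τ (g 1 1) := by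
  simp [twistFun]

/-- `twistFun` as a group homomorphism. -/
def twist (τ : F →+* F) (c : F) (hc : c ≠ 0) : SL(2, F) →* SL(2, F) where
  toFun := twistFun τ c hc
  map_one' := by simp [SL2_ext_iff, twistFun_apply]
  map_mul' g h := by
    simp only [SL2_ext_iff, SL2_mul_apply, twistFun_apply, map_add, map_mul]
    refine ⟨?_, ?_, ?_, ?_⟩ <;> field_simp

theorem twist_apply (τ : F →+* F) {c : F} (hc : c ≠ 0) (g : SL(2, F)) :
    twist τ c hc g 0 0 = τ (g 0 0) ∧ twist τ c hc g 0 1 = c * τ (g 0 1) ∧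
      twist τ c hc g 1 0 = c⁻¹ * τ (g 1 0) ∧ twist τ c hc g 1 1 = τ (g 1 1) :=
  twistFun_apply τ hc g

/-- The trace of an element of `SL₂`. -/
def tr (g : SL(2, F)) : F := g 0 0 + g 1 1

theorem tr_neg (g : SL(2, F)) : tr (-g) = -tr g := by
  simp only [tr, SL2_neg_apply]; ring

theorem tr_inv (g : SL(2, F)) : tr g⁻¹ = tr g := by
  simp only [tr, SL2_inv]; ring

theorem tr_mul_comm (g h : SL(2, F)) : tr (g * h) = tr (h * g) := by
  simp only [tr, SL2_mul_apply]; ring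

theorem tr_mul_mul_self (g h : SL(2, F)) : tr (g * (g * h)) = tr g * tr (g * h) - tr h := by
  have := SL2_det g
  simp only [tr, SL2_mul_apply]
  linear_combination (-h 0 0 - h 1 1) * this

/-- Automorphisms of `PSL₂` over a finite field act on squared traces by field endomorphisms. -/
theorem exists_ringHom_tr_sq [Finite F]
    (σ : SL(2, F) ⧸ Subgroup.center SL(2, F) ≃* SL(2, F) ⧸ Subgroup.center SL(2, F)) :
    ∃ τ : F →+* F, ∀ g k, σ (proj g) = proj k → τ (tr g ^ 2) = tr k ^ 2 := by
  obtain ⟨h, s, r, hs, hr⟩ := exists_conj_upper_lower σ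
  let σ' := σ.trans (MulAut.conj (proj h)⁻¹)
  have hσ' : ∀ x k, σ x = proj (h * k * h⁻¹) → σ' x = proj k := by
    intro x k hx
    change MulAut.conj (proj h)⁻¹ (σ x) = _
    rw [hx, MulAut.conj_apply, map_mul, map_mul, map_inv]
    group
  obtain ⟨τ, c, hc, hu, hl⟩ := exists_ringHom_of_normalized σ' (hσ' _ _ hs) (hσ' _ _ hr)
  have heq : σ'.toMonoidHom.comp proj = proj.comp (twist τ c hc) := by
    refine monoidHom_ext_of_upper_lower (fun t => ?_) fun t => ?_
    · change σ' (proj (upper t)) = proj (twist τ c hc (upper t))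
      rw [hu]
      congr 1
      simp [SL2_ext_iff, twist_apply, upper_apply]
    · change σ' (proj (lower t)) = proj (twist τ c hc (lower t))
      rw [hl]
      congr 1
      simp [SL2_ext_iff, twist_apply, lower_apply]
  refine ⟨τ, fun g k hgk => ?_⟩
  have h1 : σ' (proj g) = proj (twist τ c hc g) := DFunLike.congr_fun heq g
  have h2 := hσ' (proj g) (h⁻¹ * k * h) (by rw [hgk]; congr 1; group)
  have h3 : tr (h⁻¹ * k * h) = tr k := by rw [tr_mul_comm, ← mul_assoc]; simp
  have h4 : tr (twist τ c hc g) = τ (tr g) := by simp only [tr, twist_apply, map_add]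
  rw [map_pow, ← h4, ← h3]
  rcases proj_eq_proj_iff.mp (h1.symm.trans h2) with h | h <;> rw [h]
  rw [tr_neg, neg_sq]

theorem commute_of_tr_eq_two {g h : SL(2, F)} (hg : tr g = 2) (hh : tr h = 2)
    (hgh : tr (g * h) = 2) : Commute g h := by
  have dg := SL2_det g
  have dh := SL2_det h
  rw [Commute, SemiconjBy]
  simp only [tr, SL2_ext_iff, SL2_mul_apply] at *
  have e1 : (g 0 0 - 1) * h 0 1 - (h 0 0 - 1) * g 0 1 = 0 := pow_eq_zero_iff two_ne_zero |>.mp (by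
    grind)
  have e2 : (g 0 0 - 1) * h 1 0 - (h 0 0 - 1) * g 1 0 = 0 := pow_eq_zero_iff two_ne_zero |>.mp (by
    grind)
  have e3 : g 0 1 * h 1 0 - g 1 0 * h 0 1 = 0 := pow_eq_zero_iff two_ne_zero |>.mp (by
    grind)
  grind

theorem commute_proj_of_tr_eq_zero {g h : SL(2, F)} (hg : tr g = 0) (hh : tr h = 0)
    (hgh : tr (g * h) = 0) : Commute (proj g) (proj h) := by
  rw [Commute, SemiconjBy, ← map_mul, ← map_mul, proj_eq_proj_iff]
  right
  simp only [tr, SL2_ext_iff, SL2_neg_apply, SL2_mul_apply] at *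
  grind

theorem commute_proj_of_tr_sq {g h : SL(2, F)} (h1 : tr g ^ 2 = tr h ^ 2)
    (h2 : tr h ^ 2 = tr (g * h) ^ 2) (h3 : tr g ^ 2 = tr (g * (g * h)) ^ 2) :
    Commute (proj g) (proj h) := by
  rw [tr_mul_mul_self] at h3
  by_cases h0 : tr g = 0
  · exact commute_proj_of_tr_eq_zero h0 (by grind) (by grind)
  have h4 : (2 - tr g) * (2 + tr g) = 0 := by grind
  obtain ⟨g', hg', hgg⟩ : ∃ g', tr g' = 2 ∧ (g' = g ∨ g' = -g) := by
    rcases mul_eq_zero.mp h4 with h | h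
    · exact ⟨g, by linear_combination -h, .inl rfl⟩
    · exact ⟨-g, by rw [tr_neg]; linear_combination -h, .inr rfl⟩
  obtain ⟨h', hh', hhh⟩ : ∃ h', tr h' = 2 ∧ (h' = h ∨ h' = -h) := by
    have h5 : (2 - tr h) * (2 + tr h) = 0 := by linear_combination h4 + h1
    rcases mul_eq_zero.mp h5 with h | h
    · exact ⟨_, by linear_combination -h, .inl rfl⟩
    · exact ⟨_, by rw [tr_neg]; linear_combination -h, .inr rfl⟩
  have h2' : tr h' ^ 2 = tr (g' * h') ^ 2 := by
    rcases hgg with rfl | rfl <;> rcases hhh with rfl | rfl <;> simpa [tr_neg] using h2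
  have h3' : tr g' ^ 2 = (tr g' * tr (g' * h') - tr h') ^ 2 := by
    rcases hgg with rfl | rfl <;> rcases hhh with rfl | rfl <;>
      first
      | exact h3
      | simp only [neg_mul, mul_neg, neg_neg, tr_neg]; linear_combination h3
  have h2ne : (2 : F) ≠ 0 := by
    rintro h
    rw [h, zero_sub, zero_add] at h4
    exact h0 (by simpa using h4)
  have hgh' : tr (g' * h') = 2 := by
    rw [hg', hh'] at h3'
    rw [hh'] at h2'
    have h8 : 2 * (2 * (2 * (tr (g' * h') - 2))) = 0 := by linear_combination h3' - 4 * h2'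
    simpa [h2ne, sub_eq_zero] using h8
  rw [← proj_eq_proj_iff.mpr hgg, ← proj_eq_proj_iff.mpr hhh]
  exact (commute_of_tr_eq_two hg' hh' hgh').map proj

end SL2

theorem not_isCharacteristicQuotientOfF2_PSL2 (F : Type*) [Field F] [Finite F] :
    ¬ IsCharacteristicQuotientOfF2 (SL(2, F) ⧸ Subgroup.center SL(2, F)) := by
  rintro ⟨φ, hφ, hker⟩
  obtain ⟨X, hX⟩ := proj_surjective (φ (.of 0))
  obtain ⟨Y, hY⟩ := proj_surjective (φ (.of 1))
  refine not_commute_upper_lower (F := F) (commute_of_commute_generators hφ ?_ _ _)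
  obtain ⟨ρ, hρ⟩ := exists_mulEquiv_comp hφ hker rotateAut
  obtain ⟨σ, hσ⟩ := exists_mulEquiv_comp hφ hker swapAut
  obtain ⟨θ, hθ⟩ := exists_mulEquiv_comp hφ hker shearAut
  have hρX : ρ (proj X) = proj Y := by
    rw [hX, hρ, hY]
    simp [rotateAut]
  have hρY : ρ (proj Y) = proj (X * Y)⁻¹ := by
    rw [hY, hρ, map_inv, map_mul, hX, hY]
    simp [rotateAut]
  have hρXY : ρ (proj (X * Y)) = proj X⁻¹ := by
    rw [map_mul, map_mul, hρX, hρY, ← map_mul, mul_inv_rev, mul_inv_cancel_left]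
  have hσX : σ (proj X) = proj Y := by
    rw [hX, hσ, hY]
    simp [swapAut]
  have hσY : σ (proj Y) = proj X := by
    rw [hY, hσ, hX]
    simp [swapAut]
  have hσXY : σ (proj (X * Y)) = proj (Y * X) := by
    rw [map_mul, map_mul, hσX, hσY, ← map_mul]
  have hθX : θ (proj X) = proj X := by
    rw [hX, hθ]
    simp [shearAut]
  have hθY : θ (proj Y) = proj (X * Y) := by
    rw [hY, hθ, map_mul, hX, hY]
    simp [shearAut]
  have hθXY : θ (proj (X * Y)) = proj (X * (X * Y)) := by
    rw [map_mul, map_mul, hθX, hθY, ← map_mul]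
  obtain ⟨r, hr⟩ := exists_ringHom_tr_sq ρ
  obtain ⟨s, hs⟩ := exists_ringHom_tr_sq σ
  obtain ⟨t, ht⟩ := exists_ringHom_tr_sq θ
  replace hρX := hr _ _ hρX
  replace hρY := hr _ _ hρY
  replace hρXY := hr _ _ hρXY
  replace hσX := hs _ _ hσX
  replace hσY := hs _ _ hσY
  replace hσXY := hs _ _ hσXY
  replace hθX := ht _ _ hθX
  replace hθXY := ht _ _ hθXY
  rw [tr_inv] at hρY hρXY
  rw [tr_mul_comm Y X] at hσXY
  have hac : tr X ^ 2 = tr (X * Y) ^ 2 := by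
    have := ringHom_comm_apply r s (tr X ^ 2)
    rwa [hσX, hρX, hρY, hσY, eq_comm] at this
  have hab : tr X ^ 2 = tr Y ^ 2 := by rw [← hρX, hac, hρXY, hac]
  rw [← hX, ← hY]
  refine commute_proj_of_tr_sq hab (hab.symm.trans hac) ?_
  rw [← hθXY, ← hac, hθX]

end CharacteristicQuotient

/-- For every prime power `q` (i.e. for every finite field `F`), neither `SL₂(F_q)` nor
`PSL₂(F_q)` is a characteristic quotient of `F₂`. -/
theorem sl2_psl2_not_characteristic_quotients (F : Type) [Field F] [Fintype F] :
    ¬ IsCharacteristicQuotientOfF2 (Matrix.SpecialLinearGroup (Fin 2) F) ∧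
    ¬ IsCharacteristicQuotientOfF2
        (Matrix.SpecialLinearGroup (Fin 2) F ⧸
          Subgroup.center (Matrix.SpecialLinearGroup (Fin 2) F)) :=
  have h := CharacteristicQuotient.not_isCharacteristicQuotientOfF2_PSL2 F
  ⟨fun hF => h hF.quotient_center, h⟩
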